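/- arXiv:1506.02096 — 2 statements merged into one kernel-verified Lean document; each statement's English description precedes it below -/
import Mathlib

section
/- Every ordered rooted tree T with rank R(T) = W ≥ 2 has a corner-W-witness, i.e., a left-corner-W-witness or a right-corner-W-witness. -/
/-- A finite (ordered) rooted tree: a root together with the list of subtrees
rooted at its children, listed from left to right. -/
inductive RTree : Type where
  | node : List RTree → RTree

namespace RTree

/-- The subtrees rooted at the children of the root, from left to right. -/
def children : RTree → List RTree
  | node cs => cs

/-- A rank-`W`-witness for a tree whose root has `rs.length ≥ 1` children,
where `rs` is the list of ranks of the children subtrees (left to right,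
`0`-indexed).  It consists of a set `big` of big children (the others are
small), a coordinate `X` with `1 ≤ X ≤ W`, and the index `v` of the
vertical child, which must be big, subject to (R1ℓ), (R1r), (R2ℓ), (R2r)
and (R3). -/
def IsRankWitness (rs : List ℕ) (W : ℕ) (big : Finset (Fin rs.length)) (X : ℕ)
    (v : Fin rs.length) : Prop :=
  1 ≤ X ∧ X ≤ W ∧ v ∈ big ∧
  -- (R1ℓ): at most X-1 big children are strictly left of c_v
  ((big.filter fun i => i < v).card < X) ∧
  -- (R1r): at most W-X big children are strictly right of c_v
  ((big.filter fun i => v < i).card + X ≤ W) ∧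
  -- (R2ℓ): every small child left of c_v has rank ≤ X-1-ℓ_i
  (∀ i : Fin rs.length, i ∉ big → i < v →
      rs.get i + (big.filter fun j => j < i).card + 1 ≤ X) ∧
  -- (R2r): every small child right of c_v has rank ≤ W-X-r_i
  (∀ i : Fin rs.length, i ∉ big → v < i →
      rs.get i + (big.filter fun j => i < j).card + X ≤ W) ∧
  -- (R3): injective rank-bounds π : big → {1,…,W} dominating the ranks
  (∃ π : Fin rs.length → ℕ,
      (∀ i ∈ big, rs.get i ≤ π i ∧ 1 ≤ π i ∧ π i ≤ W) ∧
      Set.InjOn π big)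

/-- `T` (with child rank list `rs`) has some rank-`W`-witness. -/
def hasRankWitness (rs : List ℕ) (W : ℕ) : Prop :=
  ∃ (big : Finset (Fin rs.length)) (X : ℕ) (v : Fin rs.length),
    IsRankWitness rs W big X v

/-- Rank of a tree, given the list of ranks of the children of the root:
`1` for a single node, else the smallest `W ≥ 1` admitting a rank-`W`-witness. -/
noncomputable def rankAux (rs : List ℕ) : ℕ :=
  if rs = [] then 1 else sInf {W | 1 ≤ W ∧ hasRankWitness rs W}

/-- The rank `R(T)` of an ordered rooted tree. -/
noncomputable def rank : RTree → ℕ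
  | node cs => rankAux (cs.attach.map fun c => rank c.1)
decreasing_by have := List.sizeOf_lt_of_mem c.2; simp only [RTree.node.sizeOf_spec]; omega

/-- A left-corner-`W`-witness, given the list `rs` of ranks of the children of
the root: a number `W'` with `1 ≤ W' ≤ W+1` and indices
`σ(W') < … < σ(W)` (1-based positions in `{1,…,d}`, so the rank of child
`σ w` is `rs.getD (σ w - 1) 0`) satisfying (C1) and (C2), where by
convention `σ(W'-1) = 0` and `σ(W+1) = d+1`. -/
def IsLeftCornerWitness (rs : List ℕ) (W W' : ℕ) (σ : ℕ → ℕ) : Prop :=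
  1 ≤ W' ∧ W' ≤ W + 1 ∧
  (∀ w, W' ≤ w → w ≤ W → 1 ≤ σ w ∧ σ w ≤ rs.length) ∧
  (∀ w, W' ≤ w → w + 1 ≤ W → σ w < σ (w + 1)) ∧
  -- (C1)
  (∀ w, W' ≤ w → w ≤ W → rs.getD (σ w - 1) 0 = w) ∧
  -- (C2): for `W'-1 ≤ w ≤ W`, children strictly between σ(w) and σ(w+1)
  -- have rank ≤ w-1
  (∀ w, W' ≤ w + 1 → w ≤ W → ∀ i,
      (if W' ≤ w then σ w else 0) < i →
      i < (if w + 1 ≤ W then σ (w + 1) else rs.length + 1) →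
      rs.getD (i - 1) 0 + 1 ≤ w)

/-- A right-corner-`W`-witness: the mirror notion, with
`σ(W) < … < σ(W')` and the conventions `σ(W'-1) = d+1`, `σ(W+1) = 0`. -/
def IsRightCornerWitness (rs : List ℕ) (W W' : ℕ) (σ : ℕ → ℕ) : Prop :=
  1 ≤ W' ∧ W' ≤ W + 1 ∧
  (∀ w, W' ≤ w → w ≤ W → 1 ≤ σ w ∧ σ w ≤ rs.length) ∧
  (∀ w, W' ≤ w → w + 1 ≤ W → σ (w + 1) < σ w) ∧
  -- (C1)
  (∀ w, W' ≤ w → w ≤ W → rs.getD (σ w - 1) 0 = w) ∧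
  -- (C2)
  (∀ w, W' ≤ w + 1 → w ≤ W → ∀ i,
      (if w + 1 ≤ W then σ (w + 1) else 0) < i →
      i < (if W' ≤ w then σ w else rs.length + 1) →
      rs.getD (i - 1) 0 + 1 ≤ w)

end RTree

namespace RTree

theorem core_chain (N W : ℕ) (r c π : ℕ → ℕ) (B : ℕ → Prop)
    (hc : ∀ i j, 1 ≤ i → i < j → j ≤ N → B i → c i + 1 ≤ c j)
    (hs : ∀ i, 1 ≤ i → i ≤ N → ¬ B i → r i + c i + 1 ≤ W) :
    ∀ n p : ℕ,
    (∀ i, p < i → i ≤ N → W ≤ c i + n) →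
    (∀ i, p < i → i ≤ N → B i → r i ≤ π i ∧ 1 ≤ π i ∧ π i ≤ n) →
    (∀ i j, p < i → i ≤ N → p < j → j ≤ N → B i → B j → π i = π j → i = j) →
    ∃ (W' : ℕ) (σ : ℕ → ℕ), 1 ≤ W' ∧ W' ≤ n + 1 ∧
      (∀ w, W' ≤ w → w ≤ n → p < σ w ∧ σ w ≤ N) ∧
      (∀ w, W' ≤ w → w + 1 ≤ n → σ (w + 1) < σ w) ∧
      (∀ w, W' ≤ w → w ≤ n → r (σ w) = w) ∧
      (∀ w, W' ≤ w + 1 → w ≤ n → ∀ i,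
        (if w + 1 ≤ n then σ (w + 1) else p) < i →
        i < (if W' ≤ w then σ w else N + 1) → r i + 1 ≤ w) := by
  intro n
  induction n with
  | zero =>
    intro p h1 h2 h3
    refine ⟨1, fun _ => 0, le_rfl, le_rfl, ?_, ?_, ?_, ?_⟩
    · intro w hw hw'; omega
    · intro w hw hw'; omega
    · intro w hw hw'; omega
    · intro w hw hw' i hi hi'
      have : w = 0 := by omega
      subst this
      simp at hi hi'
      exfalso
      by_cases hb : B i
      · have := h2 i hi (by omega) hb; omega
      · have := hs i (by omega) (by omega) hb
        have := h1 i hi (by omega)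
        omega
  | succ n ih =>
    intro p h1 h2 h3
    have hle : ∀ i, p < i → i ≤ N → r i ≤ n + 1 := by
      intro i hi hi'
      by_cases hb : B i
      · have := h2 i hi hi' hb; omega
      · have := hs i (by omega) hi' hb
        have := h1 i hi hi'
        omega
    have hbig : ∀ i, p < i → i ≤ N → r i = n + 1 → B i ∧ π i = n + 1 := by
      intro i hi hi' hr
      by_cases hb : B i
      · have := h2 i hi hi' hb; exact ⟨hb, by omega⟩
      · have := hs i (by omega) hi' hb
        have := h1 i hi hi'
        omega
    by_cases hk : ∃ k, p < k ∧ k ≤ N ∧ r k = n + 1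
    · obtain ⟨k, hpk, hkN, hrk⟩ := hk
      obtain ⟨hbk, hπk⟩ := hbig k hpk hkN hrk
      obtain ⟨W', σ, a1, a2, a3, a4, a5, a6⟩ := ih k
        (fun i hi hi' => by
          have := hc k i (by omega) hi hi' hbk
          have := h1 k hpk hkN
          omega)
        (fun i hi hi' hb => by
          have := h2 i (by omega) hi' hb
          have h := h3 i k (by omega) hi' hpk hkN hb hbk
          refine ⟨this.1, this.2.1, ?_⟩
          by_contra hcon
          have := h (by omega)
          omega)
        (fun i j hi hi' hj hj' => h3 i j (by omega) hi' (by omega) hj')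
      refine ⟨W', fun w => if w = n + 1 then k else σ w, a1, by omega, ?_, ?_, ?_, ?_⟩
      · intro w hw hw'
        by_cases hwn : w = n + 1
        · simp [hwn, hpk, hkN]
        · have := a3 w hw (by omega)
          simp only [hwn, if_false]; omega
      · intro w hw hw'
        by_cases hwn : w = n
        · have := a3 w hw (by omega)
          simp [hwn] at this ⊢; omega
        · have := a4 w hw (by omega)
          simp only []
          rw [if_neg (by omega), if_neg (by omega)]; exact this
      · intro w hw hw'
        by_cases hwn : w = n + 1
        · simp [hwn, hrk]
        · have := a5 w hw (by omega)
          simp only [hwn, if_false]; exact this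
      · intro w hw hw' i hi hi'
        by_cases hwn : w = n + 1
        · subst hwn
          rw [if_neg (by omega)] at hi
          rw [if_pos (by omega)] at hi'
          simp only [if_true] at hi'
          have := hle i hi (by omega)
          by_contra hcon
          obtain ⟨hb, hπ⟩ := hbig i hi (by omega) (by omega)
          have := h3 i k hi (by omega) hpk hkN hb hbk (by omega)
          omega
        · apply a6 w hw (by omega) i
          · by_cases hwn' : w = n
            · subst hwn'
              simpa using hi
            · rw [if_pos (by omega)] at hi
              simp only [] at hi
              rw [if_neg (by omega)] at hi
              rw [if_pos (by omega)]; exact hi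
          · simpa [hwn] using hi'
    · refine ⟨n + 2, fun _ => 0, by omega, by omega, ?_, ?_, ?_, ?_⟩
      · intro w hw hw'; omega
      · intro w hw hw'; omega
      · intro w hw hw'; omega
      · intro w hw hw' i hi hi'
        rw [if_neg (by omega)] at hi hi'
        have := hle i hi (by omega)
        by_contra hcon
        exact hk ⟨i, hi, by omega, by omega⟩

theorem hasRankWitness_exists (rs : List ℕ) (h : rs ≠ []) :
    ∃ W, 1 ≤ W ∧ hasRankWitness rs W := by
  have hl : 0 < rs.length := List.length_pos_iff.2 h
  refine ⟨rs.sum + rs.length, by omega, Finset.univ, 1, ⟨0, hl⟩, le_rfl, by omega,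
    Finset.mem_univ _, ?_, ?_, ?_, ?_, fun i => rs.sum + i.val + 1, ?_, ?_⟩
  · have : (Finset.univ.filter fun i : Fin rs.length => i < ⟨0, hl⟩) = ∅ := by
      ext i; simp [Fin.lt_def]
    rw [this]; simp
  · have : (Finset.univ.filter fun i : Fin rs.length => ⟨0, hl⟩ < i).card < rs.length := by
      have := Finset.card_lt_card (s := (Finset.univ.filter fun i : Fin rs.length => ⟨0, hl⟩ < i))
        (t := Finset.univ) (by
          rw [Finset.ssubset_univ_iff]
          intro hh
          have := hh ▸ Finset.mem_univ (⟨0, hl⟩ : Fin rs.length)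
          simp at this)
      simpa using this
    omega
  · intro i hi; simp at hi
  · intro i hi; simp at hi
  · intro i _
    have := List.le_sum_of_mem (rs.get_mem i)
    have := i.2
    refine ⟨?_, ?_, ?_⟩ <;> beta_reduce <;> omega
  · intro i _ j _ hij
    ext
    simp at hij
    omega

theorem rankAux_pos (rs : List ℕ) : 1 ≤ rankAux rs := by
  unfold rankAux
  split_ifs with h
  · exact le_rfl
  · exact (Nat.sInf_mem (s := {W | 1 ≤ W ∧ hasRankWitness rs W}) (hasRankWitness_exists rs h)).1

theorem rank_node (cs : List RTree) : rank (node cs) = rankAux (cs.map rank) := by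
  rw [rank]
  congr 1
  simp

theorem rank_pos (T : RTree) : 1 ≤ rank T := by
  cases T with
  | node cs => rw [rank_node]; exact rankAux_pos _

theorem corner_of_witness (rs : List ℕ) (W : ℕ) (hpos : ∀ x ∈ rs, 1 ≤ x)
    (hw : hasRankWitness rs W) :
    (∃ (W' : ℕ) (σ : ℕ → ℕ), IsLeftCornerWitness rs W W' σ) ∨
    (∃ (W' : ℕ) (σ : ℕ → ℕ), IsRightCornerWitness rs W W' σ) := by
  obtain ⟨big, X, v, hX1, hXW, hv, h1l, h1r, h2l, h2r, π, hπ, hinj⟩ := hw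
  obtain ⟨N, hN⟩ : ∃ N, N = rs.length := ⟨_, rfl⟩
  obtain ⟨r, hr⟩ : ∃ r : ℕ → ℕ, r = fun i => rs.getD (i - 1) 0 := ⟨_, rfl⟩
  obtain ⟨B, hB⟩ : ∃ B : ℕ → Prop, B = fun i => ∃ j ∈ big, j.val + 1 = i := ⟨_, rfl⟩
  obtain ⟨ρ, hρ⟩ : ∃ ρ : ℕ → ℕ, ρ = fun i => if h : i - 1 < rs.length then π ⟨i - 1, h⟩ else 0 :=
    ⟨_, rfl⟩
  obtain ⟨cl, hcl⟩ : ∃ c : ℕ → ℕ, c = fun i => (big.filter fun j => j.val + 1 < i).card :=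
    ⟨_, rfl⟩
  obtain ⟨cr, hcr⟩ : ∃ c : ℕ → ℕ, c = fun i => (big.filter fun j => i < j.val + 1).card :=
    ⟨_, rfl⟩
  have er : ∀ j : Fin rs.length, r (j.val + 1) = rs.get j := by
    intro j; subst hr; simp
  have eB : ∀ j : Fin rs.length, B (j.val + 1) ↔ j ∈ big := by
    intro j; subst hB
    constructor
    · rintro ⟨k, hk, hkj⟩
      have : k = j := by ext; omega
      exact this ▸ hk
    · intro h; exact ⟨j, h, rfl⟩
  have eρ : ∀ j : Fin rs.length, ρ (j.val + 1) = π j := by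
    intro j; subst hρ; simp
  have el : ∀ j : Fin rs.length, cl (j.val + 1) = (big.filter fun i => i < j).card := by
    intro j; subst hcl; simp
  have err : ∀ j : Fin rs.length, cr (j.val + 1) = (big.filter fun i => j < i).card := by
    intro j; subst hcr; simp
  have ex : ∀ i, 1 ≤ i → i ≤ N → ∃ j : Fin rs.length, j.val + 1 = i := by
    intro i hi hi'
    exact ⟨⟨i - 1, by omega⟩, by simp; omega⟩
  have ml : ∀ i j, i < j → B i → cl i + 1 ≤ cl j := by
    intro i j hij hb
    subst hB hcl
    obtain ⟨k, hk, rfl⟩ := hb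
    apply Finset.card_lt_card
    rw [Finset.ssubset_iff_of_subset]
    · exact ⟨k, Finset.mem_filter.2 ⟨hk, hij⟩, by simp⟩
    · intro x; simp only [Finset.mem_filter]; intro hx; exact ⟨hx.1, by omega⟩
  have mr : ∀ i j, i < j → B j → cr j + 1 ≤ cr i := by
    intro i j hij hb
    subst hB hcr
    obtain ⟨k, hk, rfl⟩ := hb
    apply Finset.card_lt_card
    rw [Finset.ssubset_iff_of_subset]
    · exact ⟨k, Finset.mem_filter.2 ⟨hk, hij⟩, by simp⟩
    · intro x; simp only [Finset.mem_filter]; intro hx; exact ⟨hx.1, by omega⟩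
  -- abstract facts
  obtain ⟨u, hu⟩ : ∃ u, u = v.val + 1 := ⟨_, rfl⟩
  have hu1 : 1 ≤ u := by omega
  have huN : u ≤ N := by have := v.2; omega
  have hBu : B u := by rw [hu, eB]; exact hv
  have f1l : cl u < X := by rw [hu, el]; exact h1l
  have f1r : cr u + X ≤ W := by rw [hu, err]; exact h1r
  have f2l : ∀ i, 1 ≤ i → i ≤ N → ¬ B i → i < u → r i + cl i + 1 ≤ X := by
    intro i hi hi' hb hiu
    obtain ⟨j, rfl⟩ := ex i hi hi'
    rw [er, el]
    exact h2l j (by rwa [eB] at hb) (by rw [Fin.lt_def]; omega)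
  have f2r : ∀ i, 1 ≤ i → i ≤ N → ¬ B i → u < i → r i + cr i + X ≤ W := by
    intro i hi hi' hb hiu
    obtain ⟨j, rfl⟩ := ex i hi hi'
    rw [er, err]
    exact h2r j (by rwa [eB] at hb) (by rw [Fin.lt_def]; omega)
  have f3 : ∀ i, 1 ≤ i → i ≤ N → B i → r i ≤ ρ i ∧ 1 ≤ ρ i ∧ ρ i ≤ W := by
    intro i hi hi' hb
    obtain ⟨j, rfl⟩ := ex i hi hi'
    rw [er, eρ]
    exact hπ j (by rwa [eB] at hb)
  have finj : ∀ i j, 1 ≤ i → i ≤ N → 1 ≤ j → j ≤ N → B i → B j → ρ i = ρ j → i = j := by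
    intro i j hi hi' hj hj' hb hb' he
    obtain ⟨i, rfl⟩ := ex i hi hi'
    obtain ⟨j, rfl⟩ := ex j hj hj'
    rw [eρ, eρ] at he
    rw [eB] at hb hb'
    rw [hinj hb hb' he]
  have fpos : ∀ i, 1 ≤ i → i ≤ N → 1 ≤ r i := by
    intro i hi hi'
    obtain ⟨j, rfl⟩ := ex i hi hi'
    rw [er]; exact hpos _ (rs.get_mem j)
  unfold IsLeftCornerWitness IsRightCornerWitness
  have hr' : ∀ i, rs.getD (i - 1) 0 = r i := by intro i; rw [hr]
  simp only [hr', ← hN]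
  clear hr' er eB eρ el err ex h1l h1r h2l h2r hπ hinj hpos hv hu v hcl hcr hρ hB hr
  have hle : ∀ i, 1 ≤ i → i ≤ N → r i ≤ W := by
    intro i hi hi'
    by_cases hb : B i
    · have := f3 i hi hi' hb; omega
    · rcases lt_trichotomy i u with h | h | h
      · have := f2l i hi hi' hb h; omega
      · subst h; exact absurd hBu hb
      · have := f2r i hi hi' hb h; omega
  have hWb : ∀ i, 1 ≤ i → i ≤ N → r i = W → B i ∧ ρ i = W := by
    intro i hi hi' hri
    by_cases hb : B i
    · have := f3 i hi hi' hb; exact ⟨hb, by omega⟩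
    · rcases lt_trichotomy i u with h | h | h
      · have := f2l i hi hi' hb h; omega
      · subst h; exact absurd hBu hb
      · have := f2r i hi hi' hb h; omega
  by_cases hk : ∃ k, 1 ≤ k ∧ k ≤ N ∧ r k = W
  swap
  · left
    refine ⟨W + 1, fun _ => 0, by omega, le_rfl, ?_, ?_, ?_, ?_⟩
    · intro w hw hw'; omega
    · intro w hw hw'; omega
    · intro w hw hw'; omega
    · intro w hw hw' i hi hi'
      rw [if_neg (by omega)] at hi hi'
      have := hle i hi (by omega)
      by_contra hcon
      exact hk ⟨i, hi, by omega, by omega⟩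
  obtain ⟨k, hk1, hkN, hrk⟩ := hk
  obtain ⟨hbk, hρk⟩ := hWb k hk1 hkN hrk
  have hlt : ∀ i, 1 ≤ i → i ≤ N → i ≠ k → r i + 1 ≤ W := by
    intro i hi hi' hik
    have := hle i hi hi'
    by_contra hcon
    obtain ⟨hb, hρ⟩ := hWb i hi hi' (by omega)
    exact hik (finj i k hi hi' hk1 hkN hb hbk (by omega))
  by_cases hL : ∃ a, 1 ≤ a ∧ a < k ∧ r a + 1 = W
  swap
  · left
    refine ⟨W, fun _ => k, by omega, by omega, ?_, ?_, ?_, ?_⟩ <;> beta_reduce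
    · intro w hw hw'; omega
    · intro w hw hw'; omega
    · intro w hw hw'; omega
    · intro w hw hw' i hi hi'
      rcases Nat.lt_or_ge w W with h | h
      · rw [if_neg (by omega)] at hi
        rw [if_pos (by omega)] at hi'
        have := hlt i hi (by omega) (by omega)
        by_contra hcon
        exact hL ⟨i, hi, hi', by omega⟩
      · rw [if_pos (by omega)] at hi
        rw [if_neg (by omega)] at hi'
        have := hlt i (by omega) (by omega) (by omega)
        omega
  by_cases hR : ∃ a, k < a ∧ a ≤ N ∧ r a + 1 = W
  swap
  · right
    refine ⟨W, fun _ => k, by omega, by omega, ?_, ?_, ?_, ?_⟩ <;> beta_reduce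
    · intro w hw hw'; omega
    · intro w hw hw'; omega
    · intro w hw hw'; omega
    · intro w hw hw' i hi hi'
      rcases Nat.lt_or_ge w W with h | h
      · rw [if_pos (by omega)] at hi
        rw [if_neg (by omega)] at hi'
        have := hlt i (by omega) (by omega) (by omega)
        by_contra hcon
        exact hR ⟨i, hi, by omega, by omega⟩
      · rw [if_neg (by omega)] at hi
        rw [if_pos (by omega)] at hi'
        have := hlt i (by omega) (by omega) (by omega)
        omega
  obtain ⟨a, ha1, hak, hra⟩ := hL
  obtain ⟨b, hkb, hbN, hrb⟩ := hR
  have hsmall : ∃ s, 1 ≤ s ∧ s ≤ N ∧ ¬ B s ∧ r s + 1 = W := by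
    by_contra hcon
    push Not at hcon
    have hBa : B a := by
      by_contra h; exact hcon a ha1 (by omega) h hra
    have hBb : B b := by
      by_contra h; exact hcon b (by omega) (by omega) h hrb
    have := f3 a ha1 (by omega) hBa
    have := f3 b (by omega) hbN hBb
    have := finj a b ha1 (by omega) (by omega) hbN hBa hBb
    have := finj a k ha1 (by omega) (by omega) hkN hBa hbk
    have := finj b k (by omega) (by omega) (by omega) hkN hBb hbk
    omega
  obtain ⟨s, hs1, hsN, hbs, hrs⟩ := hsmall
  rcases lt_trichotomy s u with h | h | h
  · have := f2l s hs1 hsN hbs h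
    have hXe : X = W := by omega
    have hu_last : ∀ i, u < i → i ≤ N → False := by
      intro i hi hi'
      by_cases hb : B i
      · have := mr u i hi hb; omega
      · have := f2r i (by omega) hi' hb hi
        have := fpos i (by omega) hi'
        omega
    right
    refine core_chain N W r cl ρ B (fun i j _ hij _ => ml i j hij) ?_ W 0
      (fun i _ _ => by omega) f3 finj
    intro i hi hi' hb
    rcases lt_trichotomy i u with h | h | h
    · have := f2l i hi hi' hb h; omega
    · subst h; exact absurd hBu hb
    · exact (hu_last i h hi').elim
  · subst h; exact absurd hBu hbs
  · have := f2r s hs1 hsN hbs h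
    have hXe : X = 1 := by omega
    have hu_first : ∀ i, i < u → 1 ≤ i → False := by
      intro i hi hi'
      by_cases hb : B i
      · have := ml i u hi hb; omega
      · have := f2l i (by omega) (by omega) hb hi
        have := fpos i (by omega) (by omega)
        omega
    left
    obtain ⟨W', σ, a1, a2, a3, a4, a5, a6⟩ := core_chain N W (fun i => r (N + 1 - i))
      (fun i => cr (N + 1 - i)) (fun i => ρ (N + 1 - i)) (fun i => B (N + 1 - i))
      (fun i j _ hij _ => mr _ _ (by omega))
      (by
        intro i hi hi' hb
        rcases lt_trichotomy (N + 1 - i) u with h | h | h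
        · exact (hu_first _ h (by omega)).elim
        · rw [← h] at hBu; exact absurd hBu hb
        · have := f2r _ (by omega) (by omega) hb h; omega) W 0
      (fun i _ _ => by omega)
      (fun i _ _ hb => f3 _ (by omega) (by omega) hb)
      (fun i j _ _ _ _ hb hb' he => by
        have := finj _ _ (by omega) (by omega) (by omega) (by omega) hb hb' he
        omega)
    refine ⟨W', fun w => N + 1 - σ w, a1, a2, ?_, ?_, a5, ?_⟩ <;> beta_reduce
    · intro w hw hw'
      have := a3 w hw hw'
      omega
    · intro w hw hw'
      have := a3 w hw (by omega)
      have := a4 w hw hw'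
      omega
    · intro w hw hw' i hi hi'
      have hiN : i ≤ N := by split_ifs at hi' <;> omega
      have key := a6 w hw hw' (N + 1 - i)
        (by
          split_ifs at hi' ⊢ with hc
          · have := a3 (w + 1) (by omega) hc; omega
          · omega)
        (by
          split_ifs at hi ⊢ with hc
          · have := a3 w hc hw'; omega
          · omega)
      have e : N + 1 - (N + 1 - i) = i := by omega
      simpa only [e] using key

/-- Every ordered rooted tree of rank `W ≥ 2` has a corner-`W`-witness,
i.e. a left-corner-`W`-witness or a right-corner-`W`-witness. -/
theorem cornerWitness_of_rank (T : RTree) (W : ℕ)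
    (hW : 2 ≤ W) (hT : rank T = W) :
    (∃ (W' : ℕ) (σ : ℕ → ℕ),
        IsLeftCornerWitness (T.children.map rank) W W' σ) ∨
    (∃ (W' : ℕ) (σ : ℕ → ℕ),
        IsRightCornerWitness (T.children.map rank) W W' σ) := by
  cases T with
  | node cs =>
    rw [rank_node] at hT
    apply corner_of_witness
    · intro x hx
      obtain ⟨t, -, rfl⟩ := List.mem_map.1 hx
      exact rank_pos t
    · change hasRankWitness (cs.map rank) W
      unfold rankAux at hT
      split_ifs at hT with h
      · omega
      · have := (Nat.sInf_mem (s := {W | 1 ≤ W ∧ hasRankWitness (cs.map rank) W})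
          (hasRankWitness_exists _ h)).2
        rwa [hT] at this

end RTree
end

section
/- Let T be an ordered rooted tree whose root has d ≥ 1 children and let W ≥ 2 be an integer. The following are equivalent: (1) T has a rank-W-witness; (2) T has a rank-W-witness with coordinate X ∈ {1, W}; (3) T has a rank-W-witness with vertical-child index v ∈ {1, d}; (4) T has a left-corner-W-witness or a right-corner-W-witness. -/
namespace RTree

/-- Rank witness with 1-based natural number positions. -/
def NW (d : ℕ) (f : ℕ → ℕ) (W : ℕ) (B : Finset ℕ) (X v : ℕ) : Prop :=
  (∀ i ∈ B, 1 ≤ i ∧ i ≤ d) ∧ 1 ≤ X ∧ X ≤ W ∧ v ∈ B ∧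
  ((B.filter fun i => i < v).card < X) ∧
  ((B.filter fun i => v < i).card + X ≤ W) ∧
  (∀ i, 1 ≤ i → i ≤ d → i ∉ B → i < v → f i + (B.filter fun j => j < i).card + 1 ≤ X) ∧
  (∀ i, 1 ≤ i → i ≤ d → i ∉ B → v < i → f i + (B.filter fun j => i < j).card + X ≤ W) ∧
  (∃ π : ℕ → ℕ, (∀ i ∈ B, f i ≤ π i ∧ 1 ≤ π i ∧ π i ≤ W) ∧ Set.InjOn π B)

def LC (d : ℕ) (f : ℕ → ℕ) (W W' : ℕ) (σ : ℕ → ℕ) : Prop :=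
  1 ≤ W' ∧ W' ≤ W + 1 ∧
  (∀ w, W' ≤ w → w ≤ W → 1 ≤ σ w ∧ σ w ≤ d) ∧
  (∀ w, W' ≤ w → w + 1 ≤ W → σ w < σ (w + 1)) ∧
  (∀ w, W' ≤ w → w ≤ W → f (σ w) = w) ∧
  (∀ w, W' ≤ w + 1 → w ≤ W → ∀ i,
      (if W' ≤ w then σ w else 0) < i →
      i < (if w + 1 ≤ W then σ (w + 1) else d + 1) →
      f i + 1 ≤ w)

def RC (d : ℕ) (f : ℕ → ℕ) (W W' : ℕ) (σ : ℕ → ℕ) : Prop :=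
  1 ≤ W' ∧ W' ≤ W + 1 ∧
  (∀ w, W' ≤ w → w ≤ W → 1 ≤ σ w ∧ σ w ≤ d) ∧
  (∀ w, W' ≤ w → w + 1 ≤ W → σ (w + 1) < σ w) ∧
  (∀ w, W' ≤ w → w ≤ W → f (σ w) = w) ∧
  (∀ w, W' ≤ w + 1 → w ≤ W → ∀ i,
      (if w + 1 ≤ W then σ (w + 1) else 0) < i →
      i < (if W' ≤ w then σ w else d + 1) →
      f i + 1 ≤ w)

/-- Reflection of functions on positions. -/
def rv (d : ℕ) (f : ℕ → ℕ) : ℕ → ℕ := fun i => f (d + 1 - i)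

theorem RC_rev {d f W W' σ} (h : RC d (rv d f) W W' σ) :
    LC d f W W' (fun w => d + 1 - σ w) := by
  obtain ⟨h1, h2, h3, h4, h5, h6⟩ := h
  refine ⟨h1, h2, ?_, ?_, h5, ?_⟩
  · intro w a b; have := h3 w a b; show 1 ≤ d + 1 - σ w ∧ d + 1 - σ w ≤ d; omega
  · intro w a b
    have := h3 w a (by omega)
    have := h3 (w+1) (by omega) b
    have := h4 w a b
    show d + 1 - σ w < d + 1 - σ (w+1)
    omega
  · intro w a b i hi hi'
    beta_reduce at hi hi'
    have hid : i ≤ d := by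
      split_ifs at hi' with hh
      · omega
      · omega
    have := h6 w a b (d + 1 - i) (by
      split_ifs with hh
      · have := h3 (w+1) (by omega) hh
        rw [if_pos hh] at hi'
        omega
      · omega) (by
      split_ifs with hh
      · have := h3 w hh b
        rw [if_pos hh] at hi
        omega
      · rw [if_neg hh] at hi
        omega)
    simp only [rv] at this
    rwa [show d + 1 - (d + 1 - i) = i by omega] at this

theorem LC_rev {d f W W' σ} (h : RC d f W W' σ) :
    LC d (rv d f) W W' (fun w => d + 1 - σ w) := by
  apply RC_rev
  obtain ⟨h1, h2, h3, h4, h5, h6⟩ := h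
  have key : ∀ i, 1 ≤ i → i ≤ d → rv d (rv d f) i = f i := by
    intro i a b
    simp only [rv]
    rw [show d + 1 - (d + 1 - i) = i by omega]
  refine ⟨h1, h2, h3, h4, ?_, ?_⟩
  · intro w a b
    have := h3 w a b
    rw [key _ this.1 this.2]; exact h5 w a b
  · intro w a b i hi hi'
    have : i ≤ d := by
      split_ifs at hi' with hh
      · have := h3 w hh b
        omega
      · omega
    rw [key i (by omega) this]
    exact h6 w a b i hi hi'

theorem card_rev (d : ℕ) (B : Finset ℕ) (hB : ∀ i ∈ B, 1 ≤ i ∧ i ≤ d) (p q : ℕ → Prop)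
    [DecidablePred p] [DecidablePred q] (hpq : ∀ j, 1 ≤ j → j ≤ d → (p (d + 1 - j) ↔ q j)) :
    ((B.image fun i => d + 1 - i).filter p).card = (B.filter q).card := by
  rw [Finset.filter_image, Finset.card_image_of_injOn]
  · congr 1
    apply Finset.filter_congr
    intro j hj
    exact hpq j (hB j hj).1 (hB j hj).2
  · intro a ha b hb hab
    have := hB a (Finset.mem_filter.1 ha).1
    have := hB b (Finset.mem_filter.1 hb).1
    simp only at hab
    omega

theorem NW_rev {d f W B X v} (h : NW d f W B X v) :
    NW d (rv d f) W (B.image fun i => d + 1 - i) (W + 1 - X) (d + 1 - v) := by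
  obtain ⟨hB, hX1, hX2, hv, r1, r2, r3, r4, π, hπ, hinj⟩ := h
  have hvd := hB v hv
  have hmem : ∀ i, 1 ≤ i → i ≤ d → (i ∉ B.image fun i => d + 1 - i) → d + 1 - i ∉ B := by
    intro i a b hn hh
    apply hn
    rw [Finset.mem_image]
    exact ⟨_, hh, by omega⟩
  refine ⟨?_, by omega, by omega, Finset.mem_image_of_mem _ hv, ?_, ?_, ?_, ?_,
    fun i => π (d + 1 - i), ?_, ?_⟩
  · intro i hi
    rw [Finset.mem_image] at hi
    obtain ⟨j, hj, rfl⟩ := hi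
    have := hB j hj
    omega
  · rw [card_rev d B hB _ (fun i => v < i) (by intro j _ _; omega)]
    omega
  · rw [card_rev d B hB _ (fun i => i < v) (by intro j _ _; omega)]
    omega
  · intro i a b hn hlt
    rw [card_rev d B hB _ (fun j => d + 1 - i < j) (by intro j _ _; omega)]
    have := r4 (d + 1 - i) (by omega) (by omega) (hmem i a b hn) (by omega)
    simp only [rv]
    omega
  · intro i a b hn hlt
    rw [card_rev d B hB _ (fun j => j < d + 1 - i) (by intro j _ _; omega)]
    have := r3 (d + 1 - i) (by omega) (by omega) (hmem i a b hn) (by omega)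
    simp only [rv]
    omega
  · intro i hi
    rw [Finset.mem_image] at hi
    obtain ⟨j, hj, rfl⟩ := hi
    have := hB j hj
    simp only [rv]
    rw [show d + 1 - (d + 1 - j) = j by omega]
    exact hπ j hj
  · intro i hi k hk hik
    rw [Finset.mem_coe, Finset.mem_image] at hi hk
    obtain ⟨j, hj, rfl⟩ := hi
    obtain ⟨l, hl, rfl⟩ := hk
    have := hB j hj
    have := hB l hl
    simp only at hik
    rw [show d + 1 - (d + 1 - j) = j by omega, show d + 1 - (d + 1 - l) = l by omega] at hik
    rw [hinj hj hl hik]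

theorem rv_rv_NW {d f W B X v} (h : NW d (rv d (rv d f)) W B X v) : NW d f W B X v := by
  have key : ∀ i, 1 ≤ i → i ≤ d → rv d (rv d f) i = f i := by
    intro i a b
    simp only [rv]
    rw [show d + 1 - (d + 1 - i) = i by omega]
  obtain ⟨hB, hX1, hX2, hv, r1, r2, r3, r4, π, hπ, hinj⟩ := h
  refine ⟨hB, hX1, hX2, hv, r1, r2, ?_, ?_, π, ?_, hinj⟩
  · intro i a b
    rw [← key i a b]; exact r3 i a b
  · intro i a b
    rw [← key i a b]; exact r4 i a b
  · intro i hi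
    rw [← key i (hB i hi).1 (hB i hi).2]; exact hπ i hi

theorem chain {d W : ℕ} {f : ℕ → ℕ} {B : Finset ℕ} (hB : ∀ i ∈ B, 1 ≤ i ∧ i ≤ d)
    (hs : ∀ i, 1 ≤ i → i ≤ d → i ∉ B → f i + (B.filter fun j => j < i).card + 1 ≤ W)
    (hall : ∃ π : ℕ → ℕ, (∀ i ∈ B, f i ≤ π i ∧ 1 ≤ π i ∧ π i ≤ W) ∧ Set.InjOn π B)
    (pos : ∀ i, 1 ≤ i → i ≤ d → 1 ≤ f i) : ∃ W' σ, RC d f W W' σ := by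
  by_contra hno
  obtain ⟨π, hπ, hinj⟩ := hall
  have claim : ∀ k w, w + k = W + 1 → ∃ σ : ℕ → ℕ,
      (∀ u, w ≤ u → u ≤ W → σ u ∈ B ∧ f (σ u) = u) ∧
      (∀ u u', w ≤ u → u < u' → u' ≤ W → σ u' < σ u) ∧
      (∀ u, w ≤ u → u ≤ W → ∀ i, (if u + 1 ≤ W then σ (u + 1) else 0) < i →
        i < σ u → f i + 1 ≤ u) := by
    intro k
    induction k with
    | zero =>
      intro w hw
      exact ⟨fun _ => 0, fun u _ _ => by omega, fun u u' _ _ _ => by omega,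
        fun u _ _ => by omega⟩
    | succ k ih =>
      intro w hw
      obtain ⟨σ, a1, a2, a3⟩ := ih (w + 1) (by omega)
      by_cases hex : ∃ i, (if w + 1 ≤ W then σ (w + 1) else 0) < i ∧ i ≤ d ∧ w ≤ f i
      · have hmin := fun {m} => Nat.find_min hex (m := m)
        obtain ⟨p1, p2, p3⟩ := Nat.find_spec hex
        set p := Nat.find hex with hp
        have hlt : ∀ u, w + 1 ≤ u → u ≤ W → σ u < p := by
          intro u b1 b2
          rw [if_pos (by omega)] at p1
          rcases Nat.eq_or_lt_of_le b1 with h | h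
          · rw [← h]; exact p1
          · exact (a2 _ _ le_rfl h b2).trans p1
        have hσinj : Set.InjOn σ (Finset.Icc (w + 1) W : Finset ℕ) := by
          intro x hx y hy hxy
          simp only [Finset.coe_Icc, Set.mem_Icc] at hx hy
          rw [← (a1 x hx.1 hx.2).2, ← (a1 y hy.1 hy.2).2, hxy]
        have hcard : ((Finset.Icc (w + 1) W).image σ).card = W - w := by
          rw [Finset.card_image_of_injOn hσinj, Nat.card_Icc]; omega
        have hpB : p ∈ B := by
          by_contra hpn
          have h1 := hs p (by omega) p2 hpn
          have h2 : ((Finset.Icc (w + 1) W).image σ).card ≤ (B.filter fun j => j < p).card := by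
            apply Finset.card_le_card
            intro x hx
            rw [Finset.mem_image] at hx
            obtain ⟨u, hu, rfl⟩ := hx
            rw [Finset.mem_Icc] at hu
            exact Finset.mem_filter.2 ⟨(a1 u hu.1 hu.2).1, hlt u hu.1 hu.2⟩
          omega
        have hfp : f p = w := by
          by_contra hne
          have hnot : p ∉ (Finset.Icc (w + 1) W).image σ := by
            intro hx
            rw [Finset.mem_image] at hx
            obtain ⟨u, hu, hup⟩ := hx
            rw [Finset.mem_Icc] at hu
            have := hlt u hu.1 hu.2
            omega
          have hsub : ∀ x ∈ insert p ((Finset.Icc (w + 1) W).image σ), x ∈ B ∧ w + 1 ≤ f x := by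
            intro x hx
            rw [Finset.mem_insert, Finset.mem_image] at hx
            rcases hx with rfl | ⟨u, hu, rfl⟩
            · exact ⟨hpB, by omega⟩
            · rw [Finset.mem_Icc] at hu
              have := a1 u hu.1 hu.2
              exact ⟨this.1, by omega⟩
          have := Finset.card_le_card_of_injOn (t := Finset.Icc (w + 1) W) π
            (fun x hx => by
              have h := hsub x hx
              have := hπ x h.1
              simp only [Finset.coe_Icc, Set.mem_Icc]
              omega)
            (fun x hx y hy hxy => hinj (hsub x hx).1 (hsub y hy).1 hxy)
          rw [Finset.card_insert_of_notMem hnot, hcard, Nat.card_Icc] at this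
          omega
        refine ⟨Function.update σ w p, ?_, ?_, ?_⟩
        · intro u b1 b2
          rcases Nat.eq_or_lt_of_le b1 with h | h
          · subst h; simp [hpB, hfp]
          · rw [Function.update_of_ne (by omega)]; exact a1 u h b2
        · intro u u' b1 b2 b3
          rw [Function.update_of_ne (show u' ≠ w by omega)]
          rcases Nat.eq_or_lt_of_le b1 with h | h
          · subst h; simpa using hlt u' (by omega) b3
          · rw [Function.update_of_ne (by omega)]; exact a2 u u' h b2 b3
        · intro u b1 b2 i
          rw [Function.update_of_ne (show u + 1 ≠ w by omega)]
          rcases Nat.eq_or_lt_of_le b1 with h | h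
          · subst h
            intro c1 c2
            rw [Function.update_self] at c2
            by_contra hc
            exact hmin c2 ⟨c1, by omega, by omega⟩
          · rw [Function.update_of_ne (by omega)]; exact a3 u h b2 i
      · exfalso
        apply hno
        refine ⟨w + 1, σ, by omega, by omega, fun u b1 b2 => hB _ (a1 u b1 b2).1,
          fun u b1 b2 => a2 _ _ b1 (by omega) b2, fun u b1 b2 => (a1 u b1 b2).2, ?_⟩
        intro u b1 b2 i c1 c2
        by_cases h : w + 1 ≤ u
        · rw [if_pos h] at c2
          exact a3 u h b2 i c1 c2
        · have : u = w := by omega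
          subst this
          rw [if_neg h] at c2
          by_contra hc
          exact hex ⟨i, c1, by omega, by omega⟩
  obtain ⟨σ, a1, -, -⟩ := claim (W + 1) 0 (by omega)
  obtain ⟨h1, h2⟩ := a1 0 le_rfl (by omega)
  have := hB _ h1
  have := pos _ this.1 this.2
  omega

theorem half {d f W B X v} (h : NW d f W B X v) (pos : ∀ i, 1 ≤ i → i ≤ d → 1 ≤ f i)
    {p m : ℕ} (hp1 : 1 ≤ p) (hpm : p < m) (hm : m ∈ B) (hpB : p ∉ B) (hfp : W ≤ f p + 1) :
    ∃ W' σ, RC d f W W' σ := by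
  obtain ⟨hB, hX1, hX2, hv, r1, r2, r3, r4, hall⟩ := h
  have hmd := hB m hm
  have hXW : X = W := by
    rcases lt_trichotomy p v with hlt | rfl | hlt
    · have := r3 p hp1 (by omega) hpB hlt
      omega
    · exact absurd hv hpB
    · have h1 := r4 p hp1 (by omega) hpB hlt
      have : 0 < (B.filter fun j => p < j).card :=
        Finset.card_pos.2 ⟨m, Finset.mem_filter.2 ⟨hm, hpm⟩⟩
      omega
  subst hXW
  refine chain hB ?_ hall pos
  intro i a b hi
  rcases lt_trichotomy i v with hlt | rfl | hlt
  · exact r3 i a b hi hlt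
  · exact absurd hv hi
  · have h1 := r4 i a b hi hlt
    have := pos i a b
    omega

theorem NW_corner {d f W B X v} (hW : 2 ≤ W) (h : NW d f W B X v)
    (pos : ∀ i, 1 ≤ i → i ≤ d → 1 ≤ f i) :
    (∃ W' σ, LC d f W W' σ) ∨ (∃ W' σ, RC d f W W' σ) := by
  have h' := h
  obtain ⟨hB, hX1, hX2, hv, r1, r2, r3, r4, π, hπ, hinj⟩ := h'
  have hsm : ∀ i, 1 ≤ i → i ≤ d → i ∉ B → f i < W := by
    intro i a b hi
    rcases lt_trichotomy i v with hlt | rfl | hlt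
    · have := r3 i a b hi hlt; omega
    · exact absurd hv hi
    · have := r4 i a b hi hlt; omega
  have hle : ∀ i, 1 ≤ i → i ≤ d → f i ≤ W := by
    intro i a b
    by_cases hi : i ∈ B
    · have := hπ i hi; omega
    · exact (hsm i a b hi).le
  by_cases hm : ∃ m, 1 ≤ m ∧ m ≤ d ∧ f m = W
  swap
  · left
    refine ⟨W + 1, fun _ => 0, by omega, by omega, fun w _ _ => by omega,
      fun w _ _ => by omega, fun w _ _ => by omega, ?_⟩
    intro w a b i c1 c2
    have hw : w = W := by omega
    subst hw
    simp at c1 c2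
    have := hle i (by omega) (by omega)
    have : f i ≠ w := fun hh => hm ⟨i, by omega, by omega, hh⟩
    omega
  obtain ⟨m, hm1, hm2, hfm⟩ := hm
  have hmB : m ∈ B := by
    by_contra hn
    have := hsm m hm1 hm2 hn
    omega
  have hlt : ∀ i, 1 ≤ i → i ≤ d → i ≠ m → f i < W := by
    intro i a b hne
    by_contra hc
    have hiB : i ∈ B := by
      by_contra hn
      exact hc (hsm i a b hn)
    apply hne
    apply hinj hiB hmB
    have := hπ i hiB
    have := hπ m hmB
    omega
  by_cases hp : ∃ p, 1 ≤ p ∧ p < m ∧ W ≤ f p + 1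
  swap
  · left
    refine ⟨W, fun _ => m, by omega, by omega, fun w _ _ => ⟨hm1, hm2⟩,
      fun w _ _ => by omega, fun w _ _ => by beta_reduce; omega, ?_⟩
    intro w a b i c1 c2
    beta_reduce at c1 c2
    split_ifs at c1 c2 with e1 e2 e2
    · omega
    · have := hlt i (by omega) (by omega) (by omega)
      omega
    · by_contra hc
      exact hp ⟨i, by omega, c2, by omega⟩
    · omega
  by_cases hq : ∃ q, m < q ∧ q ≤ d ∧ W ≤ f q + 1
  swap
  · right
    refine ⟨W, fun _ => m, by omega, by omega, fun w _ _ => ⟨hm1, hm2⟩,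
      fun w _ _ => by omega, fun w _ _ => by beta_reduce; omega, ?_⟩
    intro w a b i c1 c2
    beta_reduce at c1 c2
    split_ifs at c1 c2 with e1 e2 e2
    · omega
    · by_contra hc
      exact hq ⟨i, c1, by omega, by omega⟩
    · have := hlt i (by omega) (by omega) (by omega)
      omega
    · omega
  obtain ⟨p, hp1, hp2, hp3⟩ := hp
  obtain ⟨q, hq1, hq2, hq3⟩ := hq
  by_cases hpB : p ∈ B
  swap
  · right
    exact half h pos hp1 hp2 hmB hpB hp3
  by_cases hqB : q ∈ B
  swap
  · left
    obtain ⟨W', σ, hσ⟩ := half (NW_rev h) (fun i a b => pos (d + 1 - i) (by omega) (by omega))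
      (p := d + 1 - q) (m := d + 1 - m) (by omega) (by omega)
      (Finset.mem_image_of_mem _ hmB)
      (by
        intro hx
        rw [Finset.mem_image] at hx
        obtain ⟨j, hj, hjq⟩ := hx
        have := hB j hj
        have : j = q := by omega
        exact hqB (this ▸ hj))
      (by
        simp only [rv]
        rw [show d + 1 - (d + 1 - q) = q by omega]
        exact hq3)
    exact ⟨W', _, RC_rev hσ⟩
  exfalso
  have e1 : π p ≠ π q := fun hh => by have := hinj hpB hqB hh; omega
  have e2 : π p ≠ π m := fun hh => by have := hinj hpB hmB hh; omega
  have e3 : π q ≠ π m := fun hh => by have := hinj hqB hmB hh; omega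
  have := hπ p hpB
  have := hπ q hqB
  have := hπ m hmB
  omega

theorem LC_NW {d f W W' σ} (hd : 1 ≤ d) (hW : 2 ≤ W) (h : LC d f W W' σ) :
    ∃ B, NW d f W B 1 1 := by
  classical
  obtain ⟨h1, h2, h3, h4, h5, h6⟩ := h
  have hmono : ∀ n u, W' ≤ u → u + n ≤ W → σ u + n ≤ σ (u + n) := by
    intro n
    induction n with
    | zero => intro u _ _; simp
    | succ n ih =>
      intro u a b
      have := ih u a (by omega)
      have := h4 (u + n) (by omega) (by omega)
      rw [← add_assoc, ← add_assoc]
      omega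
  have hmono' : ∀ u w, W' ≤ u → u ≤ w → w ≤ W → σ u ≤ σ w := by
    intro u w a b c
    have := hmono (w - u) u a (by omega)
    rw [show u + (w - u) = w by omega] at this
    omega
  -- the status of position one
  have hone : (W' ≤ W ∧ σ W' = 1) ∨ f 1 + 1 ≤ W' - 1 := by
    by_cases hh : W' ≤ W ∧ σ W' = 1
    · exact Or.inl hh
    · right
      have := h6 (W' - 1) (by omega) (by omega) 1 (by rw [if_neg (by omega)]; omega) (by
        rw [show W' - 1 + 1 = W' by omega]
        split_ifs with e
        · have := h3 W' le_rfl e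
          have : σ W' ≠ 1 := fun x => hh ⟨e, x⟩
          omega
        · omega)
      exact this
  set B : Finset ℕ := insert 1 ((Finset.Icc W' W).image σ) with hBdef
  have hmemB : ∀ i, i ∈ B ↔ i = 1 ∨ ∃ u, W' ≤ u ∧ u ≤ W ∧ σ u = i := by
    intro i
    simp [hBdef, and_assoc]
  refine ⟨B, ?_, le_rfl, by omega, by simp [hBdef], ?_, ?_, ?_, ?_,
    fun i => if (∃ u, W' ≤ u ∧ u ≤ W ∧ σ u = i) then f i else W' - 1, ?_, ?_⟩
  · intro i hi
    rcases (hmemB i).1 hi with rfl | ⟨u, a, b, rfl⟩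
    · omega
    · exact h3 u a b
  · rw [Finset.card_eq_zero.2]
    · omega
    · apply Finset.filter_eq_empty_iff.2
      intro i hi
      rcases (hmemB i).1 hi with rfl | ⟨u, a, b, rfl⟩
      · omega
      · have := h3 u a b; omega
  · have : (B.filter fun i => 1 < i) ⊆ (Finset.Icc (max 2 W') W).image σ := by
      intro i hi
      rw [Finset.mem_filter] at hi
      rcases (hmemB i).1 hi.1 with rfl | ⟨u, a, b, rfl⟩
      · omega
      · apply Finset.mem_image_of_mem
        rw [Finset.mem_Icc]
        refine ⟨?_, b⟩
        rw [max_le_iff]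
        refine ⟨?_, a⟩
        by_contra hu
        have h11 : W' = 1 := by omega
        have h12 : u = W' := by omega
        subst h12
        rcases hone with e | e <;> omega
    have h7 := Finset.card_le_card this
    have h8 := Finset.card_image_le (s := Finset.Icc (max 2 W') W) (f := σ)
    rw [Nat.card_Icc] at h8
    have := le_max_left 2 W'
    omega
  · intro i _ _ _ hi
    omega
  · intro i a b hi hlt
    -- find the gap containing the position
    have hns : ∀ u, W' ≤ u → u ≤ W → σ u ≠ i := fun u c e hh =>
      hi ((hmemB i).2 (Or.inr ⟨u, c, e, hh⟩))
    have hgap : ∃ w, W' ≤ w + 1 ∧ w ≤ W ∧ (if W' ≤ w then σ w else 0) < i ∧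
        i < (if w + 1 ≤ W then σ (w + 1) else d + 1) := by
      by_contra hc
      have : ∀ n, W' - 1 + n ≤ W → (if W' ≤ W' - 1 + n then σ (W' - 1 + n) else 0) < i := by
        intro n
        induction n with
        | zero => intro _; rw [if_neg (by omega)]; omega
        | succ n ih =>
          intro hn
          have h9 := ih (by omega)
          rw [if_pos (by omega)]
          by_contra hcc
          apply hc
          refine ⟨W' - 1 + n, by omega, by omega, h9, ?_⟩
          rw [if_pos (by omega)]
          have := hns (W' - 1 + (n + 1)) (by omega) hn
          rw [add_assoc]
          omega
      have h9 := this (W + 1 - W') (by omega)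
      rw [show W' - 1 + (W + 1 - W') = W by omega] at h9
      exact hc ⟨W, by omega, le_rfl, h9, by rw [if_neg (by omega)]; omega⟩
    obtain ⟨w, c1, c2, c3, c4⟩ := hgap
    have h9 := h6 w c1 c2 i c3 c4
    have : (B.filter fun j => i < j) ⊆ (Finset.Icc (w + 1) W).image σ := by
      intro j hj
      rw [Finset.mem_filter] at hj
      rcases (hmemB j).1 hj.1 with rfl | ⟨u, a, b, rfl⟩
      · omega
      · apply Finset.mem_image_of_mem
        rw [Finset.mem_Icc]
        refine ⟨?_, b⟩
        by_contra hu
        have := hmono' u w a (by omega) c2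
        rw [if_pos (by omega)] at c3
        omega
    have h7 := Finset.card_le_card this
    have h8 := Finset.card_image_le (s := Finset.Icc (w + 1) W) (f := σ)
    rw [Nat.card_Icc] at h8
    omega
  · intro i hi
    simp only
    split_ifs with e
    · obtain ⟨u, a, b, rfl⟩ := e
      rw [h5 u a b]
      omega
    · rcases (hmemB i).1 hi with rfl | e'
      · rcases hone with o | o
        · exact absurd ⟨W', le_rfl, o.1, o.2⟩ e
        · omega
      · exact absurd e' e
  · intro i hi j hj hij
    simp only at hij
    have hi' := (hmemB i).1 hi
    have hj' := (hmemB j).1 hj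
    split_ifs at hij with e1 e2 e2
    · obtain ⟨u, a, b, rfl⟩ := e1
      obtain ⟨u', a', b', rfl⟩ := e2
      rw [h5 u a b, h5 u' a' b'] at hij
      rw [hij]
    · obtain ⟨u, a, b, rfl⟩ := e1
      rw [h5 u a b] at hij
      omega
    · obtain ⟨u, a, b, rfl⟩ := e2
      rw [h5 u a b] at hij
      omega
    · rcases hi' with rfl | x
      · rcases hj' with rfl | y
        · rfl
        · exact absurd y e2
      · exact absurd x e1

theorem RC_NW {d f W W' σ} (hd : 1 ≤ d) (hW : 2 ≤ W) (h : RC d f W W' σ) :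
    ∃ B, NW d f W B W d := by
  obtain ⟨B, hB⟩ := LC_NW hd hW (LC_rev h)
  have := rv_rv_NW (NW_rev hB)
  simp only [Nat.add_sub_cancel] at this
  exact ⟨_, this⟩

/-- Positions of a list as 1-based natural numbers. -/
def pe (n : ℕ) : Fin n ↪ ℕ := ⟨fun i => i.1 + 1, fun a b h => by
  apply Fin.ext; simpa using h⟩

theorem card_pe {n : ℕ} (big : Finset (Fin n)) (p : ℕ → Prop) (q : Fin n → Prop)
    [DecidablePred p] [DecidablePred q] (h : ∀ i, p (i.1 + 1) ↔ q i) :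
    ((big.map (pe n)).filter p).card = (big.filter q).card := by
  rw [Finset.filter_map, Finset.card_map]
  congr 1
  apply Finset.filter_congr
  intro i _
  exact h i

theorem mem_pe {n : ℕ} (big : Finset (Fin n)) (i : Fin n) :
    i.1 + 1 ∈ big.map (pe n) ↔ i ∈ big :=
  Finset.mem_map' (pe n)

theorem toNW (rs : List ℕ) (W : ℕ) (big : Finset (Fin rs.length)) (X : ℕ) (v : Fin rs.length) :
    IsRankWitness rs W big X v ↔
      NW rs.length (fun i => rs.getD (i - 1) 0) W (big.map (pe rs.length)) X (v.1 + 1) := by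
  have hg : ∀ i : Fin rs.length, rs.getD (i.1 + 1 - 1) 0 = rs.get i := by
    intro i
    simp
  have hcl : ∀ i : Fin rs.length, ((big.map (pe rs.length)).filter fun j => j < i.1 + 1).card =
      (big.filter fun j => j < i).card := fun i => card_pe _ _ _ (by intro j; simp)
  have hcr : ∀ i : Fin rs.length, ((big.map (pe rs.length)).filter fun j => i.1 + 1 < j).card =
      (big.filter fun j => i < j).card := fun i => card_pe _ _ _ (by intro j; simp)
  have hfin : ∀ i, 1 ≤ i → i ≤ rs.length → ∃ k : Fin rs.length, i = k.1 + 1 := by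
    intro i a b
    exact ⟨⟨i - 1, by omega⟩, by simp; omega⟩
  have hin : ∀ i ∈ big.map (pe rs.length), 1 ≤ i ∧ i ≤ rs.length := by
    intro i hi
    rw [Finset.mem_map] at hi
    obtain ⟨k, _, rfl⟩ := hi
    have := k.2
    show 1 ≤ k.1 + 1 ∧ k.1 + 1 ≤ rs.length
    omega
  constructor
  · rintro ⟨hX1, hX2, hv, r1, r2, r3, r4, π, hπ, hinj⟩
    refine ⟨hin, hX1, hX2, (mem_pe _ _).2 hv, by rwa [hcl], by rwa [hcr], ?_, ?_,
      fun i => if h : i - 1 < rs.length then π ⟨i - 1, h⟩ else 0, ?_, ?_⟩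
    · intro i a b hi hlt
      obtain ⟨k, rfl⟩ := hfin i a b
      rw [mem_pe] at hi
      rw [hcl]
      simp only [hg]
      exact r3 k hi (by simpa using hlt)
    · intro i a b hi hlt
      obtain ⟨k, rfl⟩ := hfin i a b
      rw [mem_pe] at hi
      rw [hcr]
      simp only [hg]
      exact r4 k hi (by simpa using hlt)
    · intro i hi
      obtain ⟨a, b⟩ := hin i hi
      obtain ⟨k, rfl⟩ := hfin i a b
      rw [mem_pe] at hi
      simp only [hg]
      simpa using hπ k hi
    · intro i hi j hj hij
      rw [Finset.mem_coe] at hi hj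
      obtain ⟨a, b⟩ := hin i hi
      obtain ⟨k, rfl⟩ := hfin i a b
      obtain ⟨a', b'⟩ := hin j hj
      obtain ⟨l, rfl⟩ := hfin j a' b'
      rw [mem_pe] at hi hj
      simp at hij
      rw [hinj hi hj hij]
  · rintro ⟨_, hX1, hX2, hv, r1, r2, r3, r4, π, hπ, hinj⟩
    rw [mem_pe] at hv
    rw [hcl] at r1
    rw [hcr] at r2
    refine ⟨hX1, hX2, hv, r1, r2, ?_, ?_, fun i => π (i.1 + 1), ?_, ?_⟩
    · intro i hi hlt
      have := r3 (i.1 + 1) (by omega) (by omega) (by rwa [mem_pe]) (by simpa using hlt)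
      rw [hcl] at this
      simp only [hg] at this
      exact this
    · intro i hi hlt
      have := r4 (i.1 + 1) (by omega) (by omega) (by rwa [mem_pe]) (by simpa using hlt)
      rw [hcr] at this
      simp only [hg] at this
      exact this
    · intro i hi
      have := hπ (i.1 + 1) (by rwa [mem_pe])
      simp only [hg] at this
      exact this
    · intro i hi j hj hij
      have := hinj (Finset.mem_coe.2 ((mem_pe big i).2 hi))
        (Finset.mem_coe.2 ((mem_pe big j).2 hj)) hij
      apply Fin.ext
      omega

theorem ofNW (rs : List ℕ) (W : ℕ) (B : Finset ℕ) (X v : ℕ)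
    (h : NW rs.length (fun i => rs.getD (i - 1) 0) W B X v) :
    ∃ (big : Finset (Fin rs.length)) (v' : Fin rs.length),
      IsRankWitness rs W big X v' ∧ v'.1 + 1 = v := by
  have hB := h.1
  have hv := hB v h.2.2.2.1
  refine ⟨Finset.univ.filter fun i => i.1 + 1 ∈ B, ⟨v - 1, by omega⟩, ?_, by simp; omega⟩
  rw [toNW]
  have e1 : (Finset.univ.filter fun i : Fin rs.length => i.1 + 1 ∈ B).map (pe rs.length) = B := by
    ext i
    simp only [Finset.mem_map, Finset.mem_filter, Finset.mem_univ, true_and, pe]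
    constructor
    · rintro ⟨k, hk, rfl⟩
      exact hk
    · intro hi
      have := hB i hi
      refine ⟨⟨i - 1, by omega⟩, ?_, ?_⟩
      · simp only
        rwa [show i - 1 + 1 = i by omega]
      · show i - 1 + 1 = i
        omega
  rw [e1]
  simp only
  rwa [show v - 1 + 1 = v by omega]

theorem main_aux (rs : List ℕ) (W : ℕ) (hne : rs ≠ []) (hW : 2 ≤ W)
    (hpos : ∀ r ∈ rs, 1 ≤ r) :
    List.TFAE
      [ (∃ (big : Finset (Fin rs.length)) (X : ℕ) (v : Fin rs.length),
          IsRankWitness rs W big X v),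
        (∃ (big : Finset (Fin rs.length)) (X : ℕ) (v : Fin rs.length),
          IsRankWitness rs W big X v ∧ (X = 1 ∨ X = W)),
        (∃ (big : Finset (Fin rs.length)) (X : ℕ) (v : Fin rs.length),
          IsRankWitness rs W big X v ∧ ((v : ℕ) = 0 ∨ (v : ℕ) + 1 = rs.length)),
        ((∃ (W' : ℕ) (σ : ℕ → ℕ), IsLeftCornerWitness rs W W' σ) ∨
          (∃ (W' : ℕ) (σ : ℕ → ℕ), IsRightCornerWitness rs W W' σ)) ] := by
  have hl : 1 ≤ rs.length := List.length_pos_of_ne_nil hne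
  have hL : ∀ W' σ, IsLeftCornerWitness rs W W' σ ↔
      LC rs.length (fun i => rs.getD (i - 1) 0) W W' σ := fun _ _ => Iff.rfl
  have hR : ∀ W' σ, IsRightCornerWitness rs W W' σ ↔
      RC rs.length (fun i => rs.getD (i - 1) 0) W W' σ := fun _ _ => Iff.rfl
  have h4 : ((∃ (W' : ℕ) (σ : ℕ → ℕ), IsLeftCornerWitness rs W W' σ) ∨
          (∃ (W' : ℕ) (σ : ℕ → ℕ), IsRightCornerWitness rs W W' σ)) →
      ∃ (big : Finset (Fin rs.length)) (X : ℕ) (v : Fin rs.length),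
          IsRankWitness rs W big X v ∧ (X = 1 ∨ X = W) ∧
            ((v : ℕ) = 0 ∨ (v : ℕ) + 1 = rs.length) := by
    rintro (⟨W', σ, h⟩ | ⟨W', σ, h⟩)
    · obtain ⟨B, hB⟩ := LC_NW hl hW ((hL _ _).1 h)
      obtain ⟨big, v, hb, hv⟩ := ofNW _ _ _ _ _ hB
      exact ⟨big, 1, v, hb, Or.inl rfl, Or.inl (by omega)⟩
    · obtain ⟨B, hB⟩ := RC_NW hl hW ((hR _ _).1 h)
      obtain ⟨big, v, hb, hv⟩ := ofNW _ _ _ _ _ hB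
      exact ⟨big, W, v, hb, Or.inr rfl, Or.inr hv⟩
  tfae_have 2 → 1 := fun ⟨b, X, v, h, _⟩ => ⟨b, X, v, h⟩
  tfae_have 3 → 1 := fun ⟨b, X, v, h, _⟩ => ⟨b, X, v, h⟩
  tfae_have 4 → 2 := fun h => by
    obtain ⟨b, X, v, h, h2, _⟩ := h4 h
    exact ⟨b, X, v, h, h2⟩
  tfae_have 4 → 3 := fun h => by
    obtain ⟨b, X, v, h, _, h3⟩ := h4 h
    exact ⟨b, X, v, h, h3⟩
  tfae_have 1 → 4 := by
    rintro ⟨b, X, v, h⟩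
    refine NW_corner hW ((toNW _ _ _ _ _).1 h) ?_
    intro i a b
    apply hpos
    rw [List.getD_eq_getElem _ _ (by omega)]
    exact List.getElem_mem _
  tfae_finish

end RTree

namespace RTree

/-- For an ordered rooted tree whose root has `d ≥ 1` children and `W ≥ 2`,
the following are equivalent: (1) `T` has a rank-`W`-witness; (2) `T` has a
rank-`W`-witness with coordinate `X ∈ {1, W}`; (3) `T` has a
rank-`W`-witness with vertical-child index `v ∈ {1, d}` (indices `0` and
`d-1` in our 0-based indexing); (4) `T` has a left-corner-`W`-witness or a
right-corner-`W`-witness. -/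
theorem rankWitness_tfae (T : RTree) (W : ℕ)
    (hne : T.children ≠ []) (hW : 2 ≤ W) :
    List.TFAE
      [ (∃ (big : Finset (Fin (T.children.map rank).length)) (X : ℕ)
          (v : Fin (T.children.map rank).length),
          IsRankWitness (T.children.map rank) W big X v),
        (∃ (big : Finset (Fin (T.children.map rank).length)) (X : ℕ)
          (v : Fin (T.children.map rank).length),
          IsRankWitness (T.children.map rank) W big X v ∧ (X = 1 ∨ X = W)),
        (∃ (big : Finset (Fin (T.children.map rank).length)) (X : ℕ)
          (v : Fin (T.children.map rank).length),
          IsRankWitness (T.children.map rank) W big X v ∧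
            ((v : ℕ) = 0 ∨ (v : ℕ) + 1 = (T.children.map rank).length)),
        ((∃ (W' : ℕ) (σ : ℕ → ℕ),
            IsLeftCornerWitness (T.children.map rank) W W' σ) ∨
          (∃ (W' : ℕ) (σ : ℕ → ℕ),
            IsRightCornerWitness (T.children.map rank) W W' σ)) ] := by
  apply main_aux _ _ (by simpa using hne) hW
  intro r hr
  rw [List.mem_map] at hr
  obtain ⟨t, _, rfl⟩ := hr
  exact rank_pos t

end RTree
end
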